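/- arXiv:1904.04071 — 4 statements merged into one kernel-verified Lean document; each statement's English description precedes it below -/
import Mathlib

section
/- Let q = 2^n, let a, b, c ∈ GF(q)*, and let E be a k-subset of GF(q). Then Σ_{α ∈ GF(q)} f̂_E(aα) · f̂_E(bα) · f̂_E(cα) = q · (q² − 6kq + 12k² − 8·N_E(a, b, c)) (equivalently, (1/q) Σ_{α ∈ GF(q)} f̂_E(aα) f̂_E(bα) f̂_E(cα) = q² − 6kq + 12k² − 8·N_E(a, b, c)). -/
open Finset

noncomputable instance (n : ℕ) : Fintype (GaloisField 2 n) := Fintype.ofFinite _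

/-- The absolute trace map from `GF(2^n)` to `GF(2)`. -/
noncomputable def Tr (n : ℕ) (x : GaloisField 2 n) : ZMod 2 :=
  Algebra.trace (ZMod 2) (GaloisField 2 n) x

/-- The characteristic function of a subset `B ⊆ GF(2^n)`. -/
noncomputable def charFun {n : ℕ} (B : Set (GaloisField 2 n)) (x : GaloisField 2 n) : ZMod 2 :=
  open scoped Classical in if x ∈ B then 1 else 0

/-- The Walsh transform of a Boolean function on `GF(2^n)`, as an integer. -/
noncomputable def walsh {n : ℕ} (f : GaloisField 2 n → ZMod 2) (μ : GaloisField 2 n) : ℤ :=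
  ∑ x : GaloisField 2 n, (-1 : ℤ) ^ (f x + Tr n (μ * x)).val

/-- The orbit of a base block `B ⊆ GF(2^n)` under the general affine group `GA₁(2^n)`,
i.e. the set of all blocks `aB + b` with `a ≠ 0`. -/
def affOrbit {n : ℕ} (B : Set (GaloisField 2 n)) : Set (Set (GaloisField 2 n)) :=
  {S | ∃ a b : GaloisField 2 n, a ≠ 0 ∧ S = (fun x => a * x + b) '' B}

/-- `N_E(a,b,c)`: the number of triples `(x,y,z) ∈ E³` with `ax + by + cz = 0`. -/
noncomputable def NE {n : ℕ} (E : Set (GaloisField 2 n)) (a b c : GaloisField 2 n) : ℕ :=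
  Nat.card {t : GaloisField 2 n × GaloisField 2 n × GaloisField 2 n //
    t.1 ∈ E ∧ t.2.1 ∈ E ∧ t.2.2 ∈ E ∧ a * t.1 + b * t.2.1 + c * t.2.2 = 0}

/-- `I_B(u₁,u₂,u₃)`: the number of pairs `(x,y) ∈ GF(2^n)²` with `uᵢ x + y ∈ B` for `i = 1,2,3`. -/
noncomputable def IB {n : ℕ} (B : Set (GaloisField 2 n)) (u₁ u₂ u₃ : GaloisField 2 n) : ℕ :=
  Nat.card {p : GaloisField 2 n × GaloisField 2 n //
    u₁ * p.1 + p.2 ∈ B ∧ u₂ * p.1 + p.2 ∈ B ∧ u₃ * p.1 + p.2 ∈ B}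

/-- The incidence structure `(GF(2^n), affOrbit B)` is a 3-design: there is a `λ` such that
every 3-subset of points lies in exactly `λ` blocks of the orbit. -/
def Is3Design {n : ℕ} (B : Set (GaloisField 2 n)) : Prop :=
  ∃ lam : ℕ, ∀ u v w : GaloisField 2 n, u ≠ v → u ≠ w → v ≠ w →
    Nat.card {S : Set (GaloisField 2 n) // S ∈ affOrbit B ∧ u ∈ S ∧ v ∈ S ∧ w ∈ S} = lam

/-- The canonical additive character `x ↦ (-1) ^ Tr x` of `GF(2^n)`, with integer values. -/
noncomputable def traceChar (n : ℕ) : AddChar (GaloisField 2 n) ℤ where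
  toFun x := (-1) ^ (Tr n x).val
  map_zero_eq_one' := by simp [Tr]
  map_add_eq_mul' x y := by
    have h : ∀ s t : ZMod 2, (-1 : ℤ) ^ (s + t).val = (-1) ^ s.val * (-1) ^ t.val := by decide
    simp only [Tr, map_add, h]

lemma traceChar_apply (n : ℕ) (x : GaloisField 2 n) : traceChar n x = (-1) ^ (Tr n x).val := rfl

lemma traceChar_isPrimitive (n : ℕ) : (traceChar n).IsPrimitive := by
  intro a ha h
  refine ha ((traceForm_nondegenerate (ZMod 2) (GaloisField 2 n)).1 a fun y ↦ ?_)
  have h1 : ∀ t : ZMod 2, (-1 : ℤ) ^ t.val = 1 → t = 0 := by decide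
  have h2 := DFunLike.congr_fun h y
  rw [AddChar.mulShift_apply, traceChar_apply, AddChar.one_apply] at h2
  exact h1 _ h2

open scoped Classical in
lemma sum_traceChar_mul (n : ℕ) (μ : GaloisField 2 n) :
    ∑ x, traceChar n (μ * x) = if μ = 0 then (Fintype.card (GaloisField 2 n) : ℤ) else 0 := by
  have h := AddChar.sum_mulShift μ (traceChar_isPrimitive n)
  simp only [mul_comm _ μ] at h
  rw [h]
  split_ifs <;> simp

open scoped Classical in
lemma walsh_charFun {n : ℕ} (E : Set (GaloisField 2 n)) (μ : GaloisField 2 n) :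
    walsh (charFun E) μ = (if μ = 0 then (Fintype.card (GaloisField 2 n) : ℤ) else 0)
      - 2 * ∑ x ∈ E.toFinset, traceChar n (μ * x) := by
  have h : ∀ t : ZMod 2, (-1 : ℤ) ^ (1 + t).val = - (-1) ^ t.val := by decide
  rw [← sum_traceChar_mul, walsh, mul_sum, ← Finset.sum_filter_add_sum_filter_not univ (· ∈ E),
    ← Finset.sum_filter_add_sum_filter_not univ (· ∈ E) fun x ↦ traceChar n (μ * x)]
  have hE : E.toFinset = univ.filter (· ∈ E) := by ext; simp
  have h1 : ∑ x with x ∈ E, (-1 : ℤ) ^ (charFun E x + Tr n (μ * x)).val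
      = ∑ x with x ∈ E, - traceChar n (μ * x) := by
    refine sum_congr rfl fun x hx ↦ ?_
    rw [charFun, if_pos (mem_filter.1 hx).2, h, traceChar_apply]
  have h2 : ∑ x with x ∉ E, (-1 : ℤ) ^ (charFun E x + Tr n (μ * x)).val
      = ∑ x with x ∉ E, traceChar n (μ * x) := by
    refine sum_congr rfl fun x hx ↦ ?_
    rw [charFun, if_neg (mem_filter.1 hx).2, zero_add, traceChar_apply]
  rw [h1, h2, hE, sum_neg_distrib, ← mul_sum]
  ring

open scoped Classical in
lemma NE_eq_card_filter {n : ℕ} (E : Set (GaloisField 2 n)) (a b c : GaloisField 2 n) :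
    NE E a b c = #{t ∈ E.toFinset ×ˢ E.toFinset ×ˢ E.toFinset |
      a * t.1 + b * t.2.1 + c * t.2.2 = 0} := by
  rw [NE, Nat.card_eq_fintype_card, Fintype.card_subtype]
  congr 1
  ext t
  simp [and_assoc]

open scoped Classical in
lemma sum_traceChar_triple {n : ℕ} (E : Set (GaloisField 2 n)) (a b c : GaloisField 2 n) :
    ∑ α, (∑ x ∈ E.toFinset, traceChar n (a * α * x)) *
        (∑ x ∈ E.toFinset, traceChar n (b * α * x)) * (∑ x ∈ E.toFinset, traceChar n (c * α * x))
      = Fintype.card (GaloisField 2 n) * NE E a b c := by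
  have h (α : GaloisField 2 n) : (∑ x ∈ E.toFinset, traceChar n (a * α * x)) *
        (∑ x ∈ E.toFinset, traceChar n (b * α * x)) * (∑ x ∈ E.toFinset, traceChar n (c * α * x))
      = ∑ t ∈ E.toFinset ×ˢ E.toFinset ×ˢ E.toFinset,
          traceChar n ((a * t.1 + b * t.2.1 + c * t.2.2) * α) := by
    rw [mul_assoc, sum_mul_sum, sum_mul_sum, sum_product]
    simp only [sum_product, mul_sum]
    refine sum_congr rfl fun x _ ↦ sum_congr rfl fun y _ ↦ sum_congr rfl fun z _ ↦ ?_
    rw [← AddChar.map_add_eq_mul, ← AddChar.map_add_eq_mul]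
    congr 1
    ring
  simp only [h]
  rw [sum_comm]
  simp only [sum_traceChar_mul]
  rw [← sum_filter, sum_const, NE_eq_card_filter, nsmul_eq_mul, mul_comm]

/-- Lemma 2.3: the triple Walsh sum in terms of `N_E(a,b,c)`. -/
theorem stmt_3 (n k : ℕ) (hn : 0 < n) (a b c : GaloisField 2 n)
    (ha : a ≠ 0) (hb : b ≠ 0) (hc : c ≠ 0)
    (E : Set (GaloisField 2 n)) (hE : E.ncard = k) :
    (∑ α : GaloisField 2 n,
        walsh (charFun E) (a * α) * walsh (charFun E) (b * α) * walsh (charFun E) (c * α))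
      = (2 ^ n : ℤ) * ((2 ^ n : ℤ) ^ 2 - 6 * k * 2 ^ n + 12 * (k : ℤ) ^ 2
          - 8 * (NE E a b c : ℤ)) := by
  classical
  have hq : (Fintype.card (GaloisField 2 n) : ℤ) = 2 ^ n := by
    rw [← Nat.card_eq_fintype_card, GaloisField.card 2 n hn.ne']
    norm_num
  have hk : (#E.toFinset : ℤ) = k := by rw [← hE, Set.ncard_eq_toFinset_card']
  have hterm (α : GaloisField 2 n) :
      walsh (charFun E) (a * α) * walsh (charFun E) (b * α) * walsh (charFun E) (c * α)
        = (if α = 0 then ((2 ^ n - 2 * k) ^ 3 + 8 * k ^ 3 : ℤ) else 0)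
          - 8 * ((∑ x ∈ E.toFinset, traceChar n (a * α * x)) *
            (∑ x ∈ E.toFinset, traceChar n (b * α * x)) *
            (∑ x ∈ E.toFinset, traceChar n (c * α * x))) := by
    simp only [walsh_charFun, hq, mul_eq_zero, ha, hb, hc, false_or]
    split_ifs with h
    · simp only [h, mul_zero, zero_mul, AddChar.map_zero_eq_one, sum_const, nsmul_eq_mul, hk]
      ring
    · ring
  simp only [hterm]
  rw [sum_sub_distrib, ← mul_sum, sum_traceChar_triple, hq, sum_ite_eq' univ (0 : GaloisField 2 n),
    if_pos (mem_univ _)]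
  ring
end

section
/- Let q = 2^n, let B be a k-subset of GF(q) with k ≥ 3, and let E be a subset of GF(q) such that f̂_B(μ) = f̂_E(μ^d) for all μ ∈ GF(q), where d is a positive integer with gcd(d, q−1) = 1. Then the following four statements are equivalent: (1) (GF(q), GA₁(q)(B)) is a 3-design; (2) the integer Σ_{x,y ∈ GF(q)} (−1)^{f_E(x) + f_E(y) + f_E(u^d x + (1+u)^d y)} is independent of u, for u ranging over GF(q) ∖ GF(2); (3) the integer Σ_{α ∈ GF(q)} f̂_E(α) f̂_E(u^d α) f̂_E((1+u)^d α) is independent of u, for u ranging over GF(q) ∖ GF(2); (4) N_E(u^d, (1+u)^d, 1) is independent of u, for u ranging over GF(q) ∖ GF(2). -/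
open Finset

/-- The sign `(-1)^a` of an element of `ZMod 2`. -/
def zsign (a : ZMod 2) : ℤ := (-1 : ℤ) ^ a.val

theorem zsign_add (a b : ZMod 2) : zsign (a + b) = zsign a * zsign b := by
  revert a b; decide

theorem Tr_add (n : ℕ) (x y : GaloisField 2 n) : Tr n (x + y) = Tr n x + Tr n y := by
  simp [Tr]

theorem sum_zsign_Tr_mul {n : ℕ} [DecidableEq (GaloisField 2 n)] (hn : n ≠ 0)
    (c : GaloisField 2 n) :
    ∑ α : GaloisField 2 n, zsign (Tr n (α * c)) = if c = 0 then 2 ^ n else 0 := by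
  split_ifs with hc
  · subst hc
    have h := GaloisField.card 2 n hn
    rw [Nat.card_eq_fintype_card] at h
    simp [Tr, zsign, h]
  · obtain ⟨y, hy⟩ := Algebra.trace_surjective (ZMod 2) (GaloisField 2 n) 1
    obtain ⟨b, rfl⟩ : ∃ b, b * c = y := ⟨y / c, div_mul_cancel₀ y hc⟩
    have hb : Tr n (b * c) = 1 := hy
    have hs : ∑ α : GaloisField 2 n, zsign (Tr n (α * c)) =
        ∑ α : GaloisField 2 n, - zsign (Tr n (α * c)) := by
      rw [← Equiv.sum_comp (Equiv.addRight b)]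
      refine Finset.sum_congr rfl fun α _ => ?_
      rw [Equiv.coe_addRight, add_mul, Tr_add, zsign_add, hb]
      have : zsign 1 = -1 := by decide
      rw [this]; ring
    rw [Finset.sum_neg_distrib] at hs
    lia

theorem walsh_eq_sum_zsign {n : ℕ} (f : GaloisField 2 n → ZMod 2) (μ : GaloisField 2 n) :
    walsh f μ = ∑ x : GaloisField 2 n, zsign (f x) * zsign (Tr n (μ * x)) :=
  Finset.sum_congr rfl fun x _ => zsign_add (f x) (Tr n (μ * x))

theorem sum_walsh_mul_walsh_mul_walsh {n : ℕ} (hn : n ≠ 0) (f : GaloisField 2 n → ZMod 2)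
    (a b : GaloisField 2 n) :
    ∑ α : GaloisField 2 n, walsh f α * walsh f (a * α) * walsh f (b * α) =
      2 ^ n * ∑ x : GaloisField 2 n, ∑ y : GaloisField 2 n,
        zsign (f x + f y + f (a * x + b * y)) := by
  classical
  have h1 : ∀ α : GaloisField 2 n, walsh f α * walsh f (a * α) * walsh f (b * α) =
      ∑ x : GaloisField 2 n, ∑ y : GaloisField 2 n, ∑ z : GaloisField 2 n,
        zsign (f x) * zsign (f y) * zsign (f z) *
          zsign (Tr n (α * (z + (a * x + b * y)))) := by
    intro α
    rw [mul_comm (walsh f α), mul_right_comm]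
    simp only [walsh_eq_sum_zsign, Finset.sum_mul_sum]
    simp only [Finset.sum_mul]
    refine Finset.sum_congr rfl fun x _ => ?_
    rw [Finset.sum_comm]
    refine Finset.sum_congr rfl fun y _ => Finset.sum_congr rfl fun z _ => ?_
    have : α * (z + (a * x + b * y)) = α * z + (a * α * x + b * α * y) := by ring
    rw [this, Tr_add, Tr_add, zsign_add, zsign_add]
    ring
  simp only [h1]
  rw [Finset.sum_comm, Finset.mul_sum]
  refine Finset.sum_congr rfl fun x _ => ?_
  rw [Finset.sum_comm, Finset.mul_sum]
  refine Finset.sum_congr rfl fun y _ => ?_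
  rw [Finset.sum_comm]
  simp only [← Finset.mul_sum, sum_zsign_Tr_mul hn, CharTwo.add_eq_zero, mul_ite, mul_zero,
    Finset.sum_ite_eq', Finset.mem_univ, if_true, zsign_add]
  ring

theorem zsign_charFun {n : ℕ} (E : Set (GaloisField 2 n)) (x : GaloisField 2 n) :
    zsign (charFun E x) = 1 - 2 * E.indicator (fun _ => (1 : ℤ)) x := by
  classical
  by_cases h : x ∈ E <;> simp [charFun, h, zsign, ZMod.val_one]

theorem NE_eq_sum_indicator {n : ℕ} (E : Set (GaloisField 2 n)) (a b : GaloisField 2 n) :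
    (NE E a b 1 : ℤ) = ∑ x : GaloisField 2 n, ∑ y : GaloisField 2 n,
      E.indicator (fun _ => (1 : ℤ)) x * E.indicator (fun _ => (1 : ℤ)) y *
        E.indicator (fun _ => (1 : ℤ)) (a * x + b * y) := by
  classical
  have e : NE E a b 1 = Nat.card {p : GaloisField 2 n × GaloisField 2 n //
      p.1 ∈ E ∧ p.2 ∈ E ∧ a * p.1 + b * p.2 ∈ E} := by
    refine Nat.card_congr
      { toFun := fun t => ⟨(t.1.1, t.1.2.1), t.2.1, t.2.2.1, ?_⟩
        invFun := fun p => ⟨(p.1.1, p.1.2, a * p.1.1 + b * p.1.2), p.2.1, p.2.2.1, p.2.2.2, ?_⟩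
        left_inv := ?_
        right_inv := fun p => rfl }
    · obtain ⟨⟨x, y, z⟩, h1, h2, h3, h4⟩ := t
      rw [one_mul, CharTwo.add_eq_zero] at h4
      simpa only [h4] using h3
    · rw [one_mul, CharTwo.add_self_eq_zero]
    · rintro ⟨⟨x, y, z⟩, h1, h2, h3, h4⟩
      rw [one_mul, CharTwo.add_eq_zero] at h4
      simp [h4]
  rw [e, Nat.card_eq_fintype_card, Fintype.card_subtype, Finset.card_filter,
    Fintype.sum_prod_type]
  push_cast
  refine Finset.sum_congr rfl fun x _ => Finset.sum_congr rfl fun y _ => ?_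
  by_cases hx : x ∈ E <;> by_cases hy : y ∈ E <;> by_cases hz : a * x + b * y ∈ E <;>
    simp [hx, hy, hz]

theorem sum_zsign_eq {n : ℕ} (hn : n ≠ 0) (E : Set (GaloisField 2 n)) {a b : GaloisField 2 n}
    (ha : a ≠ 0) (hb : b ≠ 0) :
    ∑ x : GaloisField 2 n, ∑ y : GaloisField 2 n,
        zsign (charFun E x + charFun E y + charFun E (a * x + b * y)) =
      2 ^ n * 2 ^ n - 6 * 2 ^ n * (∑ x, E.indicator (fun _ => (1 : ℤ)) x) +
        12 * (∑ x, E.indicator (fun _ => (1 : ℤ)) x) ^ 2 - 8 * NE E a b 1 := by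
  rw [NE_eq_sum_indicator]
  set e : GaloisField 2 n → ℤ := E.indicator fun _ => (1 : ℤ) with he
  have hcard : (Fintype.card (GaloisField 2 n) : ℤ) = 2 ^ n := by
    have h := GaloisField.card 2 n hn
    rw [Nat.card_eq_fintype_card] at h
    exact_mod_cast h
  have hy : ∀ x, ∑ y, e (a * x + b * y) = ∑ z, e z := fun x =>
    Equiv.sum_comp ((Equiv.mulLeft₀ b hb).trans (Equiv.addLeft (a * x))) e
  have hx : ∀ y, ∑ x, e (a * x + b * y) = ∑ z, e z := fun y =>
    Equiv.sum_comp ((Equiv.mulLeft₀ a ha).trans (Equiv.addRight (b * y))) e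
  have h3 : ∑ x, ∑ y, e (a * x + b * y) = 2 ^ n * ∑ z, e z := by
    simp [hy, hcard]
  have h13 : ∑ x, ∑ y, e x * e (a * x + b * y) = (∑ z, e z) ^ 2 := by
    simp only [← Finset.mul_sum, hy, ← Finset.sum_mul, sq]
  have h23 : ∑ x, ∑ y, e y * e (a * x + b * y) = (∑ z, e z) ^ 2 := by
    rw [Finset.sum_comm]
    simp only [← Finset.mul_sum, hx, ← Finset.sum_mul, sq]
  have h12 : ∑ x, ∑ y, e x * e y = (∑ z, e z) ^ 2 := by
    rw [← Finset.sum_mul_sum, sq]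
  have h1 : ∑ x, ∑ _y : GaloisField 2 n, e x = 2 ^ n * ∑ z, e z := by
    simp [← Finset.mul_sum, hcard]
  have h2 : ∑ _x : GaloisField 2 n, ∑ y, e y = 2 ^ n * ∑ z, e z := by
    simp [hcard]
  have h0 : ∑ _x : GaloisField 2 n, ∑ _y : GaloisField 2 n, (1 : ℤ) = 2 ^ n * 2 ^ n := by
    simp [hcard]
  have key : ∀ x y, zsign (charFun E x + charFun E y + charFun E (a * x + b * y)) =
      1 - 2 * e x - 2 * e y - 2 * e (a * x + b * y) + 4 * (e x * e y) +
        4 * (e x * e (a * x + b * y)) + 4 * (e y * e (a * x + b * y)) -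
        8 * (e x * e y * e (a * x + b * y)) := by
    intro x y
    rw [zsign_add, zsign_add, zsign_charFun, zsign_charFun, zsign_charFun]
    ring
  simp only [key, Finset.sum_add_distrib, Finset.sum_sub_distrib, ← Finset.mul_sum (a := (2:ℤ)),
    ← Finset.mul_sum (a := (4 : ℤ)), ← Finset.mul_sum (a := (8 : ℤ))] at *
  rw [h0, h1, h2, h3, h12, h13, h23]
  ring

/-- The affine images of `B`, indexed by their coefficients. -/
def affImage {n : ℕ} (B : Set (GaloisField 2 n)) (p : (GaloisField 2 n)ˣ × GaloisField 2 n) :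
    Set (GaloisField 2 n) :=
  (fun x => p.1 * x + p.2) '' B

theorem affImage_affImage {n : ℕ} (B : Set (GaloisField 2 n))
    (p r : (GaloisField 2 n)ˣ × GaloisField 2 n) :
    affImage (affImage B r) p = affImage B (p.1 * r.1, p.1 * r.2 + p.2) := by
  simp only [affImage, Set.image_image, Units.val_mul]
  refine Set.image_congr fun x _ => ?_
  ring

theorem affImage_injective {n : ℕ} (p : (GaloisField 2 n)ˣ × GaloisField 2 n) :
    Function.Injective fun B => affImage B p :=
  Set.image_injective.2 fun x y h => by simpa using h

theorem mem_affImage_iff {n : ℕ} (B : Set (GaloisField 2 n))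
    (p : (GaloisField 2 n)ˣ × GaloisField 2 n) (u : GaloisField 2 n) :
    u ∈ affImage B p ↔ ↑p.1⁻¹ * (u + p.2) ∈ B := by
  constructor
  · rintro ⟨x, hx, rfl⟩
    simpa [add_assoc, CharTwo.add_self_eq_zero] using hx
  · intro h
    exact ⟨_, h, by simp [add_assoc, CharTwo.add_self_eq_zero]⟩

theorem affImage_mem_affOrbit {n : ℕ} (B : Set (GaloisField 2 n))
    (p : (GaloisField 2 n)ˣ × GaloisField 2 n) : affImage B p ∈ affOrbit B :=
  ⟨p.1, p.2, p.1.ne_zero, rfl⟩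

theorem exists_affImage_eq {n : ℕ} {B S : Set (GaloisField 2 n)} (h : S ∈ affOrbit B) :
    ∃ p, affImage B p = S := by
  obtain ⟨a, b, ha, rfl⟩ := h
  exact ⟨(Units.mk0 a ha, b), rfl⟩

/-- Orbit-stabilizer count of the blocks in `T`. -/
theorem card_affImage_mem {n : ℕ} (B : Set (GaloisField 2 n)) (T : Set (Set (GaloisField 2 n))) :
    Nat.card {p // affImage B p ∈ T} =
      Nat.card {S : Set (GaloisField 2 n) // S ∈ affOrbit B ∧ S ∈ T} *
        Nat.card {p // affImage B p = B} := by
  rw [← Nat.card_prod]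
  have hc : ∀ S : {S : Set (GaloisField 2 n) // S ∈ affOrbit B ∧ S ∈ T},
      ∃ p, affImage B p = S.1 := fun S => exists_affImage_eq S.2.1
  choose r hr using hc
  have hcomp : ∀ (S : {S : Set (GaloisField 2 n) // S ∈ affOrbit B ∧ S ∈ T})
      (p : {p // affImage B p = B}),
      affImage B ((r S).1 * p.1.1, (r S).1 * p.1.2 + (r S).2) = S.1 := by
    intro S p
    rw [← affImage_affImage, p.2, hr]
  symm
  refine Nat.card_eq_of_bijective
    (fun z => ⟨((r z.1).1 * z.2.1.1, (r z.1).1 * z.2.1.2 + (r z.1).2), ?_⟩) ⟨?_, ?_⟩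
  · rw [hcomp]; exact z.1.2.2
  · rintro ⟨S, p⟩ ⟨S', p'⟩ h
    simp only [Subtype.mk.injEq] at h
    have hS : S = S' := by
      apply Subtype.ext
      rw [← hcomp S p, ← hcomp S' p', h]
    subst hS
    simp only [Prod.mk.injEq, mul_right_inj, add_left_inj, Units.mul_right_inj] at h
    simp only [Prod.mk.injEq, true_and]
    exact Subtype.ext (Prod.ext h.1 h.2)
  · rintro ⟨p, hp⟩
    let S : {S : Set (GaloisField 2 n) // S ∈ affOrbit B ∧ S ∈ T} :=
      ⟨affImage B p, affImage_mem_affOrbit B p, hp⟩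
    have hmul : ((r S).1 * ((r S).1⁻¹ * p.1),
        ((r S).1 : GaloisField 2 n) * (↑(r S).1⁻¹ * (p.2 + (r S).2)) + (r S).2) = p := by
      ext <;> simp [add_assoc, CharTwo.add_self_eq_zero]
    refine ⟨(S, ⟨((r S).1⁻¹ * p.1, ↑(r S).1⁻¹ * (p.2 + (r S).2)), ?_⟩), Subtype.ext hmul⟩
    apply affImage_injective (r S)
    change affImage (affImage B _) (r S) = affImage B (r S)
    rw [affImage_affImage, hmul, hr]

/-- The number of nonconstant affine maps sending `0`, `1` and `t` into `B`. -/
noncomputable def affCount {n : ℕ} (B : Set (GaloisField 2 n)) (t : GaloisField 2 n) : ℕ :=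
  Nat.card {p : (GaloisField 2 n)ˣ × GaloisField 2 n //
    p.2 ∈ B ∧ p.1 + p.2 ∈ B ∧ p.1 * t + p.2 ∈ B}

theorem card_affImage_mem_triple {n : ℕ} (B : Set (GaloisField 2 n)) {u v w : GaloisField 2 n}
    (huv : u ≠ v) :
    Nat.card {p // affImage B p ∈ {S | u ∈ S ∧ v ∈ S ∧ w ∈ S}} =
      affCount B ((u + w) / (u + v)) := by
  have hc : u + v ≠ 0 := by rwa [Ne, CharTwo.add_eq_zero]
  let c : (GaloisField 2 n)ˣ := Units.mk0 _ hc
  have hcv : (c : GaloisField 2 n) = u + v := rfl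
  refine Nat.card_congr
    (Equiv.subtypeEquiv
      { toFun := fun p => (p.1⁻¹ * c, ↑p.1⁻¹ * (u + p.2))
        invFun := fun p => (p.1⁻¹ * c, ↑(p.1⁻¹ * c) * p.2 + u)
        left_inv := ?_
        right_inv := ?_ } ?_)
  · rintro ⟨a, b⟩
    ext
    · simp
    · simp only [mul_inv_rev, inv_inv, Units.val_mul, Units.val_inv_eq_inv_val]
      have := a.ne_zero
      field_simp
      linear_combination u * CharTwo.two_eq_zero (R := GaloisField 2 n)
  · rintro ⟨a, b⟩
    ext
    · simp
    · simp only [mul_inv_rev, inv_inv, Units.val_mul, Units.val_inv_eq_inv_val]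
      have := a.ne_zero
      field_simp
      linear_combination u * a * CharTwo.two_eq_zero (R := GaloisField 2 n)
  · rintro ⟨a, b⟩
    simp only [Set.mem_ofPred_eq, mem_affImage_iff, Equiv.coe_fn_mk, Units.val_mul, hcv]
    have e1 : (↑a⁻¹ : GaloisField 2 n) * (u + v) + ↑a⁻¹ * (u + b) = ↑a⁻¹ * (v + b) := by
      linear_combination ↑a⁻¹ * u * CharTwo.two_eq_zero (R := GaloisField 2 n)
    have e2 : (↑a⁻¹ : GaloisField 2 n) * (u + v) * ((u + w) / (u + v)) + ↑a⁻¹ * (u + b) =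
        ↑a⁻¹ * (w + b) := by
      rw [mul_assoc, mul_div_cancel₀ _ hc]
      linear_combination ↑a⁻¹ * u * CharTwo.two_eq_zero (R := GaloisField 2 n)
    rw [e1, e2]

theorem is3Design_iff_affCount {n : ℕ} (B : Set (GaloisField 2 n)) :
    Is3Design B ↔ ∃ c : ℕ, ∀ t : GaloisField 2 n, t ≠ 0 → t ≠ 1 → affCount B t = c := by
  have hcount : ∀ u v w : GaloisField 2 n, u ≠ v → affCount B ((u + w) / (u + v)) =
      Nat.card {S : Set (GaloisField 2 n) // S ∈ affOrbit B ∧ u ∈ S ∧ v ∈ S ∧ w ∈ S} *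
        Nat.card {p // affImage B p = B} := fun u v w huv => by
    rw [← card_affImage_mem_triple B huv, card_affImage_mem]
    rfl
  have hpos : 0 < Nat.card {p // affImage B p = B} := by
    have : Nonempty {p // affImage B p = B} := ⟨⟨(1, 0), by simp [affImage]⟩⟩
    exact Nat.card_pos
  constructor
  · rintro ⟨lam, h⟩
    refine ⟨lam * Nat.card {p // affImage B p = B}, fun t h0 h1 => ?_⟩
    have := hcount 0 1 t zero_ne_one
    rwa [h 0 1 t zero_ne_one h0.symm h1.symm, zero_add, zero_add, div_one] at this
  · rintro ⟨c, h⟩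
    refine ⟨c / Nat.card {p // affImage B p = B}, fun u v w huv huw hvw => ?_⟩
    have hc : u + v ≠ 0 := by rwa [Ne, CharTwo.add_eq_zero]
    have := hcount u v w huv
    rw [h] at this
    · rw [this, Nat.mul_div_cancel _ hpos]
    · rw [Ne, div_eq_zero_iff, not_or, CharTwo.add_eq_zero]
      exact ⟨huw, hc⟩
    · rw [Ne, div_eq_one_iff_eq hc]
      simpa using hvw.symm

theorem NE_eq_ncard_add_affCount {n : ℕ} (B : Set (GaloisField 2 n)) (t : GaloisField 2 n) :
    NE B t (1 + t) 1 = B.ncard + affCount B t := by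
  rw [← Nat.card_coe_set_eq, affCount, ← Nat.card_sum]
  symm
  refine Nat.card_eq_of_bijective
    (Sum.elim (fun x => ⟨(x.1, x.1, x.1), x.2, x.2, x.2, ?_⟩)
      (fun p => ⟨(p.1.1 + p.1.2, p.1.2, p.1.1 * t + p.1.2), p.2.2.1, p.2.1, p.2.2.2, ?_⟩)) ⟨?_, ?_⟩
  · linear_combination (x.1 + t * x.1) * CharTwo.two_eq_zero (R := GaloisField 2 n)
  · linear_combination (t * p.1.1 + t * p.1.2 + p.1.2) *
      CharTwo.two_eq_zero (R := GaloisField 2 n)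
  · rintro (⟨x, hx⟩ | ⟨⟨a, b⟩, hp⟩) (⟨y, hy⟩ | ⟨⟨a', b'⟩, hp'⟩) h <;>
      simp only [Sum.elim_inl, Sum.elim_inr, Subtype.mk.injEq, Prod.mk.injEq] at h
    · simp [h.1]
    · exact absurd (show (a' : GaloisField 2 n) = 0 by linear_combination h.2.1 - h.1)
        a'.ne_zero
    · exact absurd (show (a : GaloisField 2 n) = 0 by linear_combination h.1 - h.2.1)
        a.ne_zero
    · have hb : b = b' := h.2.1
      have ha : a = a' := Units.ext (by linear_combination h.1 - h.2.1)
      subst ha hb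
      rfl
  · rintro ⟨⟨x, y, z⟩, hx, hy, hz, h⟩
    simp only at hx hy hz h
    have hz' : z = (x + y) * t + y := by
      rw [one_mul, CharTwo.add_eq_zero] at h
      rw [← h]; ring
    by_cases hxy : x = y
    · subst hxy
      refine ⟨Sum.inl ⟨x, hx⟩, ?_⟩
      simp [hz', CharTwo.add_self_eq_zero]
    · have hc : x + y ≠ 0 := by rwa [Ne, CharTwo.add_eq_zero]
      have hxy' : x + y + y = x := by rw [add_assoc, CharTwo.add_self_eq_zero, add_zero]
      refine ⟨Sum.inr ⟨(Units.mk0 _ hc, y), hy, ?_, ?_⟩, ?_⟩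
      · simpa [hxy'] using hx
      · simpa [← hz'] using hz
      · simp [hz', hxy']

theorem pow_bijective_of_coprime {n d : ℕ} (hn : n ≠ 0) (hd : d ≠ 0)
    (hgcd : Nat.gcd d (2 ^ n - 1) = 1) :
    Function.Bijective fun x : GaloisField 2 n => x ^ d := by
  rw [← Finite.injective_iff_bijective]
  intro x y h
  change x ^ d = y ^ d at h
  by_cases hy : y = 0
  · subst hy
    rw [zero_pow hd] at h
    exact eq_zero_of_pow_eq_zero h
  · have hx : x ≠ 0 := by
      rintro rfl
      rw [zero_pow hd] at h
      exact hy (eq_zero_of_pow_eq_zero h.symm)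
    have h1 : (x / y) ^ d = 1 := by rw [div_pow, h, div_self (pow_ne_zero _ hy)]
    have h2 : (x / y) ^ (2 ^ n - 1) = 1 := by
      have hc := GaloisField.card 2 n hn
      rw [Nat.card_eq_fintype_card] at hc
      rw [← hc]
      exact FiniteField.pow_card_sub_one_eq_one _ (div_ne_zero hx hy)
    have h3 := pow_gcd_eq_one.2 ⟨h1, h2⟩
    rw [hgcd, pow_one] at h3
    exact (div_eq_one_iff_eq hy).1 h3

/-- Theorem 2.7: four equivalent characterizations of the orbit of `B` being a 3-design,
in terms of the auxiliary set `E` with `f̂_B(μ) = f̂_E(μ^d)`. -/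
theorem stmt_7 (n k d : ℕ) (hn : 0 < n) (hk : 3 ≤ k) (hd : 0 < d)
    (hgcd : Nat.gcd d (2 ^ n - 1) = 1)
    (B E : Set (GaloisField 2 n)) (hB : B.ncard = k)
    (hBE : ∀ μ : GaloisField 2 n, walsh (charFun B) μ = walsh (charFun E) (μ ^ d)) :
    (Is3Design B ↔ ∃ c : ℤ, ∀ u : GaloisField 2 n, u ≠ 0 → u ≠ 1 →
        (∑ x : GaloisField 2 n, ∑ y : GaloisField 2 n,
          (-1 : ℤ) ^ (charFun E x + charFun E y
            + charFun E (u ^ d * x + (1 + u) ^ d * y)).val) = c) ∧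
    (Is3Design B ↔ ∃ c : ℤ, ∀ u : GaloisField 2 n, u ≠ 0 → u ≠ 1 →
        (∑ α : GaloisField 2 n, walsh (charFun E) α * walsh (charFun E) (u ^ d * α)
          * walsh (charFun E) ((1 + u) ^ d * α)) = c) ∧
    (Is3Design B ↔ ∃ c : ℕ, ∀ u : GaloisField 2 n, u ≠ 0 → u ≠ 1 →
        NE E (u ^ d) ((1 + u) ^ d) 1 = c) := by
  have hn0 : n ≠ 0 := hn.ne'
  have hu1 : ∀ u : GaloisField 2 n, u ≠ 1 → 1 + u ≠ 0 := fun u hu => by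
    rw [Ne, CharTwo.add_eq_zero]; exact hu.symm
  have hq : (2 : ℤ) ^ n ≠ 0 := by positivity
  have hwalsh : ∀ u : GaloisField 2 n,
      ∑ α : GaloisField 2 n, walsh (charFun E) α * walsh (charFun E) (u ^ d * α)
          * walsh (charFun E) ((1 + u) ^ d * α) =
        2 ^ n * ∑ x : GaloisField 2 n, ∑ y : GaloisField 2 n,
          zsign (charFun B x + charFun B y + charFun B (u * x + (1 + u) * y)) := by
    intro u
    rw [← sum_walsh_mul_walsh_mul_walsh hn0,
      ← (pow_bijective_of_coprime hn0 hd.ne' hgcd).sum_comp]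
    simp only [hBE, mul_pow]
  have hsum : ∃ K : ℤ, ∀ u : GaloisField 2 n, u ≠ 0 → u ≠ 1 →
      ∑ x : GaloisField 2 n, ∑ y : GaloisField 2 n,
        zsign (charFun E x + charFun E y + charFun E (u ^ d * x + (1 + u) ^ d * y)) =
          K - 8 * affCount B u :=
    ⟨2 ^ n * 2 ^ n - 6 * 2 ^ n * (∑ x, B.indicator (fun _ => (1 : ℤ)) x) +
        12 * (∑ x, B.indicator (fun _ => (1 : ℤ)) x) ^ 2 - 8 * B.ncard, fun u h0 h1 => by
      have h := hwalsh u
      rw [sum_walsh_mul_walsh_mul_walsh hn0, mul_right_inj' hq,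
        sum_zsign_eq hn0 B h0 (hu1 u h1), NE_eq_ncard_add_affCount] at h
      rw [h]
      push_cast
      ring⟩
  have hNE : ∃ K : ℤ, ∀ u : GaloisField 2 n, u ≠ 0 → u ≠ 1 →
      (NE E (u ^ d) ((1 + u) ^ d) 1 : ℤ) = affCount B u + K := by
    obtain ⟨K, hK⟩ := hsum
    refine ⟨(2 ^ n * 2 ^ n - 6 * 2 ^ n * (∑ x, E.indicator (fun _ => (1 : ℤ)) x) +
        12 * (∑ x, E.indicator (fun _ => (1 : ℤ)) x) ^ 2 - K) / 8, fun u h0 h1 => ?_⟩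
    have h := hK u h0 h1
    rw [sum_zsign_eq hn0 E (pow_ne_zero d h0) (pow_ne_zero d (hu1 u h1))] at h
    lia
  rw [is3Design_iff_affCount]
  obtain ⟨K, hK⟩ := hsum
  obtain ⟨L, hL⟩ := hNE
  have hone : (∃ c : ℕ, ∀ t : GaloisField 2 n, t ≠ 0 → t ≠ 1 → affCount B t = c) ↔
      ∃ c : ℤ, ∀ u : GaloisField 2 n, u ≠ 0 → u ≠ 1 →
        (∑ x : GaloisField 2 n, ∑ y : GaloisField 2 n,
          zsign (charFun E x + charFun E y + charFun E (u ^ d * x + (1 + u) ^ d * y))) = c := by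
    constructor
    · rintro ⟨c, hc⟩
      exact ⟨K - 8 * c, fun u h0 h1 => by rw [hK u h0 h1, hc u h0 h1]⟩
    · rintro ⟨c, hc⟩
      refine ⟨((K - c) / 8).toNat, fun u h0 h1 => ?_⟩
      have h := hK u h0 h1
      rw [hc u h0 h1] at h
      lia
  refine ⟨hone, hone.trans ?_, ?_⟩
  · simp only [sum_walsh_mul_walsh_mul_walsh hn0]
    constructor
    · rintro ⟨c, hc⟩
      exact ⟨2 ^ n * c, fun u h0 h1 => by rw [hc u h0 h1]⟩
    · rintro ⟨c, hc⟩
      refine ⟨c / 2 ^ n, fun u h0 h1 => ?_⟩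
      rw [← hc u h0 h1, Int.mul_ediv_cancel_left _ hq]
  · constructor
    · rintro ⟨c, hc⟩
      refine ⟨(c + L).toNat, fun u h0 h1 => ?_⟩
      have h := hL u h0 h1
      rw [hc u h0 h1] at h
      lia
    · rintro ⟨c, hc⟩
      refine ⟨(c - L).toNat, fun u h0 h1 => ?_⟩
      have h := hL u h0 h1
      rw [hc u h0 h1] at h
      lia
end

section
/- Let q = 2^n and let B be a k-subset of GF(q) with k ≥ 3. Then the following four statements are equivalent: (1) (GF(q), GA₁(q)(B)) is a 3-design; (2) the integer Σ_{x,y ∈ GF(q)} (−1)^{f_B(x) + f_B(y) + f_B(ux + (1+u)y)} is independent of u, for u ranging over GF(q) ∖ GF(2); (3) the integer Σ_{α ∈ GF(q)} f̂_B(α) f̂_B(uα) f̂_B((1+u)α) is independent of u, for u ranging over GF(q) ∖ GF(2); (4) N_B(u, 1+u, 1) is independent of u, for u ranging over GF(q) ∖ GF(2). -/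
open Finset

lemma neg_one_pow_val_add (a b : ZMod 2) :
    (-1 : ℤ) ^ (a + b).val = (-1) ^ a.val * (-1) ^ b.val := by
  revert a b; decide

open scoped Classical in
lemma sum_neg_one_pow_trace_mul {n : ℕ} (c : GaloisField 2 n) :
    ∑ α : GaloisField 2 n, (-1 : ℤ) ^ (Tr n (α * c)).val =
      if c = 0 then (Fintype.card (GaloisField 2 n) : ℤ) else 0 := by
  split_ifs with hc
  · simp [hc, Tr]
  · obtain ⟨d, hd⟩ : ∃ d, Tr n (d * c) ≠ 0 := by
      by_contra! h
      refine hc ((traceForm_nondegenerate (ZMod 2) (GaloisField 2 n)).1 c fun d => ?_)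
      rw [Algebra.traceForm_apply, mul_comm]
      exact h d
    have hd1 : Tr n (d * c) = 1 := by
      revert hd; generalize Tr n (d * c) = t; revert t; decide
    have key := Equiv.sum_comp (Equiv.addRight d)
      fun α : GaloisField 2 n => (-1 : ℤ) ^ (Tr n (α * c)).val
    have hadd : ∀ α, Tr n ((α + d) * c) = Tr n (α * c) + Tr n (d * c) := fun α => by
      simp [Tr, add_mul]
    simp only [Equiv.coe_addRight, hadd, neg_one_pow_val_add, hd1, ← Finset.sum_mul] at key
    have h1 : (-1 : ℤ) ^ (1 : ZMod 2).val = -1 := by decide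
    rw [h1] at key
    linarith

/-- In characteristic two the third entry of a triple counted by `NE B u (1 + u) 1` is determined by
the other two. -/
lemma NE_eq_sum {n : ℕ} (B : Set (GaloisField 2 n)) (u : GaloisField 2 n) :
    (NE B u (1 + u) 1 : ℤ) = ∑ x : GaloisField 2 n, ∑ y : GaloisField 2 n,
      B.indicator 1 x * B.indicator 1 y * B.indicator 1 (u * x + (1 + u) * y) := by
  classical
  have e : {t : GaloisField 2 n × GaloisField 2 n × GaloisField 2 n //
      t.1 ∈ B ∧ t.2.1 ∈ B ∧ t.2.2 ∈ B ∧ u * t.1 + (1 + u) * t.2.1 + 1 * t.2.2 = 0} ≃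
      {p : GaloisField 2 n × GaloisField 2 n //
        p.1 ∈ B ∧ p.2 ∈ B ∧ u * p.1 + (1 + u) * p.2 ∈ B} :=
    { toFun := fun t => ⟨(t.1.1, t.1.2.1), t.2.1, t.2.2.1, by
        have h := t.2.2.2.2
        rw [one_mul, CharTwo.add_eq_zero] at h
        rw [h]; exact t.2.2.2.1⟩
      invFun := fun p => ⟨(p.1.1, p.1.2, u * p.1.1 + (1 + u) * p.1.2), p.2.1, p.2.2.1, p.2.2.2, by
        rw [one_mul, CharTwo.add_self_eq_zero]⟩
      left_inv := fun t => by
        have h := t.2.2.2.2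
        rw [one_mul, CharTwo.add_eq_zero] at h
        ext <;> simp [h]
      right_inv := fun p => rfl }
  rw [NE, Nat.card_congr e, Nat.card_eq_fintype_card, Fintype.card_subtype, Finset.card_filter,
    ← Finset.univ_product_univ, Finset.sum_product]
  push_cast
  refine Finset.sum_congr rfl fun x _ => Finset.sum_congr rfl fun y _ => ?_
  by_cases hx : x ∈ B <;> by_cases hy : y ∈ B <;>
    by_cases hz : u * x + (1 + u) * y ∈ B <;> simp [hx, hy, hz]

lemma neg_one_pow_charFun {n : ℕ} (B : Set (GaloisField 2 n)) (x : GaloisField 2 n) :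
    (-1 : ℤ) ^ (charFun B x).val = 1 - 2 * B.indicator 1 x := by
  by_cases hx : x ∈ B
  · simp [charFun, hx, ZMod.val_one]
  · simp [charFun, hx]

lemma sum_comp_mul_add {n : ℕ} (g : GaloisField 2 n → ℤ) {a : GaloisField 2 n} (ha : a ≠ 0)
    (b : GaloisField 2 n) : ∑ x, g (a * x + b) = ∑ x, g x :=
  Equiv.sum_comp ((Equiv.mulLeft₀ a ha).trans (Equiv.addRight b)) g

lemma charFun_sum_eq {n : ℕ} (B : Set (GaloisField 2 n)) {u : GaloisField 2 n}
    (h0 : u ≠ 0) (h1 : u ≠ 1) :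
    ∑ x : GaloisField 2 n, ∑ y : GaloisField 2 n,
        (-1 : ℤ) ^ (charFun B x + charFun B y + charFun B (u * x + (1 + u) * y)).val =
      (Fintype.card (GaloisField 2 n) : ℤ) ^ 2
        - 6 * Fintype.card (GaloisField 2 n) * (∑ x, B.indicator 1 x)
        + 12 * (∑ x, B.indicator 1 x) ^ 2 - 8 * NE B u (1 + u) 1 := by
  have h1' : 1 + u ≠ 0 := fun h => h1 (CharTwo.add_eq_zero.1 h).symm
  rw [NE_eq_sum]
  set i : GaloisField 2 n → ℤ := B.indicator 1
  have ex : ∀ x y, (-1 : ℤ) ^ (charFun B x + charFun B y + charFun B (u * x + (1 + u) * y)).val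
      = 1 - 2 * i x - 2 * i y - 2 * i (u * x + (1 + u) * y) + 4 * (i x * i y)
        + 4 * (i x * i (u * x + (1 + u) * y)) + 4 * (i y * i (u * x + (1 + u) * y))
        - 8 * (i x * i y * i (u * x + (1 + u) * y)) := fun x y => by
    simp only [neg_one_pow_val_add, neg_one_pow_charFun]
    change (1 - 2 * i x) * (1 - 2 * i y) * (1 - 2 * i (u * x + (1 + u) * y)) = _
    ring
  have hy : ∀ x, ∑ y, i (u * x + (1 + u) * y) = ∑ y, i y := fun x => by
    simp_rw [add_comm (u * x)]; exact sum_comp_mul_add i h1' _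
  have hx : ∀ y, ∑ x, i (u * x + (1 + u) * y) = ∑ y, i y := fun y => sum_comp_mul_add i h0 _
  have hyx : ∑ x, ∑ y, i y * i (u * x + (1 + u) * y) = (∑ y, i y) * ∑ y, i y := by
    rw [Finset.sum_comm]
    simp_rw [← Finset.mul_sum, hx, ← Finset.sum_mul]
  simp only [ex, Finset.sum_add_distrib, Finset.sum_sub_distrib, ← Finset.mul_sum, hy, hyx,
    ← Finset.sum_mul]
  simp only [Finset.sum_const, Finset.card_univ, nsmul_eq_mul, ← Finset.mul_sum]
  ring

lemma walsh_sum_eq {n : ℕ} (f : GaloisField 2 n → ZMod 2) (u : GaloisField 2 n) :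
    ∑ α : GaloisField 2 n, walsh f α * walsh f (u * α) * walsh f ((1 + u) * α) =
      Fintype.card (GaloisField 2 n) * ∑ x : GaloisField 2 n, ∑ y : GaloisField 2 n,
        (-1 : ℤ) ^ (f x + f y + f (u * x + (1 + u) * y)).val := by
  classical
  have expand : ∀ α : GaloisField 2 n, walsh f α * walsh f (u * α) * walsh f ((1 + u) * α) =
      ∑ x : GaloisField 2 n, ∑ y : GaloisField 2 n, ∑ z : GaloisField 2 n,
        (-1 : ℤ) ^ (f x + f y + f z).val *
          (-1) ^ (Tr n (α * (z + (u * x + (1 + u) * y)))).val := fun α => by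
    rw [mul_comm (walsh f α), mul_right_comm, walsh, walsh, walsh, Finset.sum_mul_sum,
      Finset.sum_mul]
    refine Finset.sum_congr rfl fun x _ => ?_
    rw [Finset.sum_mul]
    refine Finset.sum_congr rfl fun y _ => ?_
    rw [Finset.mul_sum]
    refine Finset.sum_congr rfl fun z _ => ?_
    have ht : Tr n (α * (z + (u * x + (1 + u) * y))) =
        Tr n (α * z) + Tr n (u * α * x) + Tr n ((1 + u) * α * y) := by
      simp only [Tr, ← map_add]
      congr 1
      ring
    simp only [ht, neg_one_pow_val_add]
    ring
  simp_rw [expand]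
  rw [Finset.sum_comm, Finset.mul_sum]
  refine Finset.sum_congr rfl fun x _ => ?_
  rw [Finset.sum_comm, Finset.mul_sum]
  refine Finset.sum_congr rfl fun y _ => ?_
  rw [Finset.sum_comm]
  simp_rw [← Finset.mul_sum, sum_neg_one_pow_trace_mul, CharTwo.add_eq_zero]
  simp [mul_comm]

/-- Pairs `(a, b)` with `a ≠ 0` for which the image of `B` under `x ↦ a * x + b` contains three
given points. -/
def affThrough {n : ℕ} (B : Set (GaloisField 2 n)) (u v w : GaloisField 2 n) :
    Set (GaloisField 2 n × GaloisField 2 n) :=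
  {p | p.1 ≠ 0 ∧ u ∈ (fun x => p.1 * x + p.2) '' B ∧ v ∈ (fun x => p.1 * x + p.2) '' B ∧
    w ∈ (fun x => p.1 * x + p.2) '' B}

/-- The stabilizer of `B` in the general affine group, as a set of pairs `(a, b)`. -/
def affStab {n : ℕ} (B : Set (GaloisField 2 n)) : Set (GaloisField 2 n × GaloisField 2 n) :=
  {p | p.1 ≠ 0 ∧ (fun x => p.1 * x + p.2) '' B = B}

lemma affStab_card_pos {n : ℕ} (B : Set (GaloisField 2 n)) : 0 < Nat.card (affStab B) := by
  have : Nonempty (affStab B) := ⟨⟨(1, 0), by simp [affStab]⟩⟩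
  exact Nat.card_pos

lemma card_affine_fiber {n : ℕ} (B : Set (GaloisField 2 n)) {a b : GaloisField 2 n} (ha : a ≠ 0) :
    Nat.card {p : GaloisField 2 n × GaloisField 2 n // p.1 ≠ 0 ∧
      (fun x => p.1 * x + p.2) '' B = (fun x => a * x + b) '' B} = Nat.card (affStab B) := by
  have hinj : Function.Injective fun x : GaloisField 2 n => a * x + b := fun x y h => by
    simpa [ha] using h
  have hcomp : ∀ c d : GaloisField 2 n, (fun x => a * c * x + (a * d + b)) '' B =
      (fun x => a * x + b) '' ((fun x => c * x + d) '' B) := fun c d => by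
    rw [Set.image_image]
    congr 1
    ext x
    ring
  refine (Nat.card_congr (Equiv.ofBijective (fun p : affStab B =>
    ⟨(a * p.1.1, a * p.1.2 + b), mul_ne_zero ha p.2.1, by
      dsimp only; rw [hcomp, p.2.2]⟩) ⟨?_, ?_⟩)).symm
  · rintro ⟨⟨c, d⟩, hp⟩ ⟨⟨c', d'⟩, hp'⟩ h
    simpa [ha] using h
  · rintro ⟨⟨c, d⟩, hc, hp⟩
    have h1 : a * (a⁻¹ * c) = c := by field_simp
    have h2 : a * (a⁻¹ * (d - b)) + b = d := by field_simp; ring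
    refine ⟨⟨(a⁻¹ * c, a⁻¹ * (d - b)), mul_ne_zero (inv_ne_zero ha) hc, ?_⟩, ?_⟩
    · apply hinj.image_injective
      dsimp only at hp ⊢
      rw [← hcomp, h1, h2, hp]
    · simp only [h1, h2]

lemma card_affThrough_eq_mul {n : ℕ} (B : Set (GaloisField 2 n)) (u v w : GaloisField 2 n) :
    Nat.card (affThrough B u v w) =
      Nat.card {S : Set (GaloisField 2 n) // S ∈ affOrbit B ∧ u ∈ S ∧ v ∈ S ∧ w ∈ S} *
        Nat.card (affStab B) := by
  classical
  let e : affThrough B u v w ≃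
      Σ S : {S : Set (GaloisField 2 n) // S ∈ affOrbit B ∧ u ∈ S ∧ v ∈ S ∧ w ∈ S},
        {p : GaloisField 2 n × GaloisField 2 n // p.1 ≠ 0 ∧
          (fun x => p.1 * x + p.2) '' B = S.1} :=
    { toFun := fun p => ⟨⟨_, ⟨p.1.1, p.1.2, p.2.1, rfl⟩, p.2.2⟩, ⟨p.1, p.2.1, rfl⟩⟩
      invFun := fun s => ⟨s.2.1, s.2.2.1, by rw [s.2.2.2]; exact s.1.2.2⟩
      left_inv := fun p => rfl
      right_inv := by rintro ⟨⟨S, hS⟩, ⟨p, hp, h⟩⟩; dsimp only at h; subst h; rfl }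
  rw [Nat.card_congr e, Nat.card_sigma]
  have hfib : ∀ S : {S : Set (GaloisField 2 n) // S ∈ affOrbit B ∧ u ∈ S ∧ v ∈ S ∧ w ∈ S},
      Nat.card {p : GaloisField 2 n × GaloisField 2 n // p.1 ≠ 0 ∧
        (fun x => p.1 * x + p.2) '' B = S.1} = Nat.card (affStab B) := by
    rintro ⟨S, ⟨a, b, ha, rfl⟩, hS⟩
    exact card_affine_fiber B ha
  simp_rw [hfib]
  rw [Finset.sum_const, Finset.card_univ, ← Nat.card_eq_fintype_card, smul_eq_mul]

lemma NE_eq_card_affThrough_add {n : ℕ} (B : Set (GaloisField 2 n)) {u v w t : GaloisField 2 n}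
    (huv : u ≠ v) (ht : w = u + t * (v - u)) :
    NE B t (1 + t) 1 = Nat.card (affThrough B u v w) + B.ncard := by
  have h2 : (2 : GaloisField 2 n) = 0 := CharTwo.two_eq_zero
  let P : GaloisField 2 n × GaloisField 2 n × GaloisField 2 n → Prop := fun s =>
    s.1 ∈ B ∧ s.2.1 ∈ B ∧ s.2.2 ∈ B ∧ t * s.1 + (1 + t) * s.2.1 + 1 * s.2.2 = 0
  have hz : ∀ x y z, t * x + (1 + t) * y + 1 * z = 0 → z = t * x + (1 + t) * y := by
    intro x y z h
    linear_combination -h + z * h2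
  have hoff : Nat.card (affThrough B u v w) = {s | P s ∧ s.1 ≠ s.2.1}.ncard := by
    have hvu : v - u ≠ 0 := sub_ne_zero.2 huv.symm
    refine Nat.card_congr (Equiv.ofBijective (fun p : affThrough B u v w =>
      ⟨((v - p.1.2) / p.1.1, (u - p.1.2) / p.1.1, (w - p.1.2) / p.1.1), ?_⟩) ⟨?_, ?_⟩)
    · obtain ⟨⟨a, b⟩, ha, ⟨y, hy, hu⟩, ⟨x, hx, hv⟩, ⟨z, hz', hw⟩⟩ := p
      dsimp only at *
      have e1 : (v - b) / a = x := by rw [← hv]; field_simp; ring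
      have e2 : (u - b) / a = y := by rw [← hu]; field_simp; ring
      have e3 : (w - b) / a = z := by rw [← hw]; field_simp; ring
      simp only [e1, e2, e3]
      refine ⟨⟨hx, hy, hz', ?_⟩, ?_⟩
      · apply mul_left_cancel₀ ha
        dsimp only
        linear_combination t * hv + (1 + t) * hu + hw + ht + (t * v + u - b - t * b) * h2
      · intro hxy
        dsimp only at hxy
        subst hxy
        exact huv (hu.symm.trans hv)
    · rintro ⟨⟨a, b⟩, ha, h⟩ ⟨⟨a', b'⟩, ha', h'⟩ heq
      simp only [Subtype.mk.injEq, Prod.mk.injEq] at heq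
      obtain ⟨e1, e2, -⟩ := heq
      change a ≠ 0 at ha
      change a' ≠ 0 at ha'
      rw [div_eq_div_iff ha ha'] at e1 e2
      have haa : a = a' := mul_left_cancel₀ hvu (by linear_combination e2 - e1)
      subst haa
      have hb : b = b' := by linear_combination -mul_right_cancel₀ ha e1
      subst hb
      rfl
    · rintro ⟨⟨x, y, z⟩, ⟨hx, hy, hz', h⟩, hxy⟩
      dsimp only at *
      have hxy' : x - y ≠ 0 := sub_ne_zero.2 hxy
      have hzz := hz _ _ _ h
      have ha : (v - u) / (x - y) ≠ 0 := div_ne_zero hvu hxy'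
      obtain ⟨a, ha'⟩ : ∃ a, a = (v - u) / (x - y) := ⟨_, rfl⟩
      rw [← ha'] at ha
      rw [eq_div_iff hxy'] at ha'
      have ev : a * x + (u - a * y) = v := by linear_combination ha'
      have eu : a * y + (u - a * y) = u := by ring
      have ew : a * z + (u - a * y) = w := by
        linear_combination a * hzz - ht + t * ha' + a * t * y * h2
      refine ⟨⟨(a, u - a * y), ha, ⟨y, hy, eu⟩, ⟨x, hx, ev⟩, ⟨z, hz', ew⟩⟩, ?_⟩
      simp only [Subtype.mk.injEq, Prod.mk.injEq]
      refine ⟨?_, ?_, ?_⟩ <;> rw [div_eq_iff ha]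
      · linear_combination -ev
      · ring
      · linear_combination -ew
  have hdiag : B.ncard = {s | P s ∧ s.1 = s.2.1}.ncard := by
    rw [← Set.ncard_image_of_injective B (f := fun x => (x, x, x)) (fun x y h => by simpa using h)]
    congr 1
    ext ⟨x, y, z⟩
    constructor
    · rintro ⟨x, hx, h⟩
      simp only [Prod.mk.injEq] at h
      obtain ⟨rfl, rfl, rfl⟩ := h
      refine ⟨⟨hx, hx, hx, ?_⟩, rfl⟩
      linear_combination (t * x + x) * h2
    · rintro ⟨⟨hx, hy, hz', h⟩, hxy⟩
      dsimp only at hxy hx h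
      subst hxy
      refine ⟨x, hx, ?_⟩
      simp only [Prod.mk.injEq, true_and]
      linear_combination h - z * h2 - t * x * h2
  rw [hoff, hdiag, ← Set.ncard_union_eq _ (Set.toFinite _) (Set.toFinite _)]
  · change {s | P s}.ncard = _
    congr 1
    ext s
    simp only [Set.mem_ofPred_eq, Set.mem_union]
    tauto
  · rw [Set.disjoint_left]
    exact fun s h h' => h.2 h'.2

lemma is3Design_iff_NE {n : ℕ} (B : Set (GaloisField 2 n)) :
    Is3Design B ↔ ∃ c : ℕ, ∀ u : GaloisField 2 n, u ≠ 0 → u ≠ 1 → NE B u (1 + u) 1 = c := by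
  constructor
  · rintro ⟨lam, h⟩
    refine ⟨lam * Nat.card (affStab B) + B.ncard, fun u h0 h1 => ?_⟩
    rw [NE_eq_card_affThrough_add B (u := 0) (v := 1) (w := u) zero_ne_one (by ring),
      card_affThrough_eq_mul, h 0 1 u zero_ne_one h0.symm h1.symm]
  · rintro ⟨c, h⟩
    refine ⟨(c - B.ncard) / Nat.card (affStab B), fun u v w huv huw hvw => ?_⟩
    have hvu : v - u ≠ 0 := sub_ne_zero.2 huv.symm
    have hwu : w - u ≠ 0 := sub_ne_zero.2 huw.symm
    have hne := NE_eq_card_affThrough_add B (w := w) (t := (w - u) / (v - u)) huv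
      (by field_simp; ring)
    have ht1 : (w - u) / (v - u) ≠ 1 := fun e => hvw <| by
      rw [div_eq_one_iff_eq hvu] at e
      exact (sub_left_inj.1 e).symm
    rw [h _ (div_ne_zero hwu hvu) ht1, card_affThrough_eq_mul] at hne
    rw [hne, Nat.add_sub_cancel, Nat.mul_div_cancel _ (affStab_card_pos B)]

/-- Theorem 2.8 (Theorem 2.7 with `E = B` and `d = 1`): four equivalent characterizations
of the orbit of `B` being a 3-design. -/
theorem stmt_8 (n k : ℕ) (hn : 0 < n) (hk : 3 ≤ k)
    (B : Set (GaloisField 2 n)) (hB : B.ncard = k) :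
    (Is3Design B ↔ ∃ c : ℤ, ∀ u : GaloisField 2 n, u ≠ 0 → u ≠ 1 →
        (∑ x : GaloisField 2 n, ∑ y : GaloisField 2 n,
          (-1 : ℤ) ^ (charFun B x + charFun B y + charFun B (u * x + (1 + u) * y)).val) = c) ∧
    (Is3Design B ↔ ∃ c : ℤ, ∀ u : GaloisField 2 n, u ≠ 0 → u ≠ 1 →
        (∑ α : GaloisField 2 n, walsh (charFun B) α * walsh (charFun B) (u * α)
          * walsh (charFun B) ((1 + u) * α)) = c) ∧
    (Is3Design B ↔ ∃ c : ℕ, ∀ u : GaloisField 2 n, u ≠ 0 → u ≠ 1 →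
        NE B u (1 + u) 1 = c) := by
  have hq : (Fintype.card (GaloisField 2 n) : ℤ) ≠ 0 := by exact_mod_cast Fintype.card_ne_zero
  have hsum : Is3Design B ↔ ∃ c : ℤ, ∀ u : GaloisField 2 n, u ≠ 0 → u ≠ 1 →
      (∑ x : GaloisField 2 n, ∑ y : GaloisField 2 n,
        (-1 : ℤ) ^ (charFun B x + charFun B y + charFun B (u * x + (1 + u) * y)).val) = c := by
    rw [is3Design_iff_NE]
    constructor
    · rintro ⟨c, h⟩
      exact ⟨_, fun u h0 h1 => by rw [charFun_sum_eq B h0 h1, h u h0 h1]⟩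
    · rintro ⟨c, h⟩
      refine ⟨(((Fintype.card (GaloisField 2 n) : ℤ) ^ 2
        - 6 * Fintype.card (GaloisField 2 n) * (∑ x, B.indicator 1 x)
        + 12 * (∑ x, B.indicator 1 x) ^ 2 - c) / 8).toNat, fun u h0 h1 => ?_⟩
      have := h u h0 h1
      rw [charFun_sum_eq B h0 h1] at this
      omega
  refine ⟨hsum, ?_, is3Design_iff_NE B⟩
  simp_rw [walsh_sum_eq]
  rw [hsum]
  constructor
  · rintro ⟨c, h⟩
    exact ⟨_, fun u h0 h1 => by rw [h u h0 h1]⟩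
  · rintro ⟨c, h⟩
    exact ⟨c / Fintype.card (GaloisField 2 n), fun u h0 h1 => by
      rw [← h u h0 h1, Int.mul_ediv_cancel_left _ hq]⟩
end

section
/- Let q = 2^n and let σ₁, σ₂, σ₃ ∈ GF(q) be such that σ₁² ≠ σ₂ and σ₃ ≠ σ₁σ₂. Then the cubic equation x³ + σ₁x² + σ₂x + σ₃ = 0 has a unique solution x ∈ GF(2^n) if and only if Tr((σ₂ + σ₁²)³/(σ₃ + σ₁σ₂)² + 1) = 1. -/
open Finset

section CubicCharTwo

variable {F : Type*} [Field F] [Finite F] [Algebra (ZMod 2) F]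

theorem trace_sq_zmod_two (x : F) :
    Algebra.trace (ZMod 2) F (x ^ 2) = Algebra.trace (ZMod 2) F x := by
  have h := Algebra.trace_eq_of_algEquiv (FiniteField.frobeniusAlgEquivOfAlgebraic (ZMod 2) F) x
  simpa [ZMod.card] using h

theorem trace_sq_add_self (x : F) : Algebra.trace (ZMod 2) F (x ^ 2 + x) = 0 := by
  rw [map_add, trace_sq_zmod_two]
  exact CharTwo.add_self_eq_zero _

/-- Additive Hilbert 90 over `GF(2)`. -/
theorem exists_sq_add_self_eq {x : F} (hx : Algebra.trace (ZMod 2) F x = 0) :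
    ∃ v : F, v ^ 2 + v = x := by
  have : CharP F 2 := charP_of_injective_algebraMap (algebraMap (ZMod 2) F).injective 2
  let L : F →ₗ[ZMod 2] F :=
    (FiniteField.frobeniusAlgEquivOfAlgebraic (ZMod 2) F).toLinearMap + LinearMap.id
  have hL (v : F) : L v = v ^ 2 + v := by simp [L, ZMod.card]
  have hle : LinearMap.range L ≤ LinearMap.ker (Algebra.trace (ZMod 2) F) := by
    rintro _ ⟨v, rfl⟩
    rw [LinearMap.mem_ker, hL, trace_sq_add_self]
  have hker : LinearMap.ker L ≤ Submodule.span (ZMod 2) {1} := by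
    intro v hv
    rw [LinearMap.mem_ker, hL, show v ^ 2 + v = v * (v + 1) by ring, mul_eq_zero,
      CharTwo.add_eq_zero] at hv
    rcases hv with rfl | rfl
    · exact zero_mem _
    · exact Submodule.mem_span_singleton_self _
  have hker' := (Submodule.finrank_mono hker).trans_eq (finrank_span_singleton one_ne_zero)
  have htr : Module.finrank (ZMod 2) (LinearMap.range (Algebra.trace (ZMod 2) F)) = 1 := by
    rw [LinearMap.range_eq_top.mpr (Algebra.trace_surjective (ZMod 2) F), finrank_top,
      Module.finrank_self]
  have h₁ := LinearMap.finrank_range_add_finrank_ker L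
  have h₂ := LinearMap.finrank_range_add_finrank_ker (Algebra.trace (ZMod 2) F)
  have heq := Submodule.eq_of_le_of_finrank_le hle (by omega)
  obtain ⟨v, hv⟩ : x ∈ LinearMap.range L := heq ▸ LinearMap.mem_ker.mpr hx
  exact ⟨v, by rw [← hL, hv]⟩

theorem trace_cube_div_add_one_sq {s : F} (hs : s ≠ 1) :
    Algebra.trace (ZMod 2) F (s ^ 3 / (s + 1) ^ 2) = Algebra.trace (ZMod 2) F s := by
  have : CharP F 2 := charP_of_injective_algebraMap (algebraMap (ZMod 2) F).injective 2
  have h2 : (2 : F) = 0 := CharTwo.two_eq_zero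
  have hs' : s + 1 ≠ 0 := by rwa [Ne, CharTwo.add_eq_zero]
  have : s ^ 3 / (s + 1) ^ 2 = s + (((s + 1)⁻¹) ^ 2 + (s + 1)⁻¹) := by
    field_simp
    linear_combination (-s ^ 2 - s - 1) * h2
  rw [this, map_add, trace_sq_add_self, add_zero]

theorem trace_eq_of_cubic_root {d s : F} (h : s ^ 3 + d * s ^ 2 + s + 1 = 0) :
    Algebra.trace (ZMod 2) F d = Algebra.trace (ZMod 2) F s := by
  have : CharP F 2 := charP_of_injective_algebraMap (algebraMap (ZMod 2) F).injective 2
  have h2 : (2 : F) = 0 := CharTwo.two_eq_zero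
  have hs : s ≠ 0 := by rintro rfl; simp at h
  have : d = s + ((s⁻¹) ^ 2 + s⁻¹) := by
    field_simp
    linear_combination h - (s ^ 3 + s + 1) * h2
  rw [this, map_add, trace_sq_add_self, add_zero]

theorem cubic_root_unique_of_trace {d s t : F} (hd : d ≠ 1)
    (htr : Algebra.trace (ZMod 2) F d = 1)
    (hs : s ^ 3 + d * s ^ 2 + s + 1 = 0) (ht : t ^ 3 + d * t ^ 2 + t + 1 = 0) : s = t := by
  have : CharP F 2 := charP_of_injective_algebraMap (algebraMap (ZMod 2) F).injective 2
  have h2 : (2 : F) = 0 := CharTwo.two_eq_zero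
  by_contra hne
  have hs1 : s ≠ 1 := by
    rintro rfl
    exact hd (by linear_combination hs - 2 * h2)
  have hs' : s + 1 ≠ 0 := by rwa [Ne, CharTwo.add_eq_zero]
  have hst : s - t ≠ 0 := sub_ne_zero.mpr hne
  have hq : s ^ 2 * t ^ 2 + s * t + s + t = 0 := by
    apply (mul_eq_zero.mp _).resolve_left hst
    linear_combination t ^ 2 * hs - s ^ 2 * ht + (s ^ 2 * t - s * t ^ 2 + s ^ 2 - t ^ 2) * h2
  have hv : s ^ 3 / (s + 1) ^ 2 = (s ^ 2 * t / (s + 1)) ^ 2 + s ^ 2 * t / (s + 1) := by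
    field_simp
    linear_combination -s ^ 2 * hq + s ^ 3 * h2
  have h0 := trace_sq_add_self (s ^ 2 * t / (s + 1))
  rw [← hv, trace_cube_div_add_one_sq hs1, ← trace_eq_of_cubic_root hs, htr] at h0
  exact one_ne_zero h0

theorem exists_cubic_root_of_trace {d : F} (hd : d ≠ 1)
    (htr : Algebra.trace (ZMod 2) F d = 1) : ∃ s : F, s ^ 3 + d * s ^ 2 + s + 1 = 0 := by
  have : CharP F 2 := charP_of_injective_algebraMap (algebraMap (ZMod 2) F).injective 2
  have h2 : (2 : F) = 0 := CharTwo.two_eq_zero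
  let S : Set F := {s | s ≠ 1 ∧ Algebra.trace (ZMod 2) F s = 1}
  let g : F → F := fun s => s + ((s⁻¹) ^ 2 + s⁻¹)
  have hroot {s : F} (hs : s ∈ S) : s ^ 3 + g s * s ^ 2 + s + 1 = 0 := by
    have hs0 : s ≠ 0 := by
      rintro rfl
      simpa using hs.2
    simp only [g]
    field_simp
    linear_combination (s ^ 3 + s + 1) * h2
  have hmaps : Set.MapsTo g S S := by
    intro s hs
    refine ⟨fun h => hs.1 ?_, (trace_eq_of_cubic_root (hroot hs)).trans hs.2⟩
    have h3 : (s - 1) ^ 3 = 0 := by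
      have := hroot hs
      rw [h] at this
      linear_combination this + (-2 * s ^ 2 + s - 1) * h2
    exact sub_eq_zero.mp (pow_eq_zero_iff three_ne_zero |>.mp h3)
  have hinj : Set.InjOn g S := by
    intro s hs t ht hst
    have h := hroot ht
    rw [← hst] at h
    exact cubic_root_unique_of_trace (hmaps hs).1 (hmaps hs).2 (hroot hs) h
  obtain ⟨⟨s, hs⟩, hsd⟩ := Finite.surjective_of_injective
    ((hmaps.restrict_inj).mpr hinj) ⟨d, hd, htr⟩
  obtain rfl : g s = d := congrArg Subtype.val hsd
  exact ⟨s, hroot hs⟩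

theorem existsUnique_cubic_root_iff_trace {d : F} (hd : d ≠ 1) :
    (∃! s : F, s ^ 3 + d * s ^ 2 + s + 1 = 0) ↔ Algebra.trace (ZMod 2) F d = 1 := by
  have : CharP F 2 := charP_of_injective_algebraMap (algebraMap (ZMod 2) F).injective 2
  have h2 : (2 : F) = 0 := CharTwo.two_eq_zero
  constructor
  · rintro ⟨s, hs, huniq⟩
    by_contra hne
    have hs : s ^ 3 + d * s ^ 2 + s + 1 = 0 := hs
    have h01 : ∀ z : ZMod 2, z ≠ 1 → z = 0 := by decide
    have hs1 : s ≠ 1 := by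
      rintro rfl
      exact hd (by linear_combination hs - 2 * h2)
    have hs0 : s ≠ 0 := by rintro rfl; simp at hs
    have hs' : s + 1 ≠ 0 := by rwa [Ne, CharTwo.add_eq_zero]
    obtain ⟨v, hv⟩ := exists_sq_add_self_eq (x := s ^ 3 / (s + 1) ^ 2) (by
      rw [trace_cube_div_add_one_sq hs1, ← trace_eq_of_cubic_root hs]
      exact h01 _ hne)
    obtain ⟨t, rfl⟩ : ∃ t, v = s ^ 2 * t / (s + 1) :=
      ⟨(s + 1) * v / s ^ 2, by field_simp⟩
    have hq : s ^ 2 * t ^ 2 + s * t + s + t = 0 := by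
      field_simp at hv
      apply (mul_eq_zero.mp _).resolve_left (pow_ne_zero 2 hs0)
      linear_combination s ^ 2 * hv + s ^ 3 * h2
    have ht : t ^ 3 + d * t ^ 2 + t + 1 = 0 := by
      apply (mul_eq_zero.mp _).resolve_left (pow_ne_zero 2 hs0)
      linear_combination t ^ 2 * hs - (s - t) * hq +
        (s ^ 2 * t - s * t ^ 2 + s ^ 2 - t ^ 2) * h2
    obtain rfl : t = s := huniq t ht
    have h4 : (t * (t + 1)) ^ 2 = 0 := by
      linear_combination hq + (t ^ 3 - t) * h2
    exact mul_ne_zero hs0 hs' (pow_eq_zero_iff two_ne_zero |>.mp h4)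
  · intro htr
    obtain ⟨s, hs⟩ := exists_cubic_root_of_trace hd htr
    exact ⟨s, hs, fun t ht => cubic_root_unique_of_trace hd htr ht hs⟩

theorem existsUnique_depressed_cubic_root_iff_trace {a b : F} (ha : a ≠ 0) (hb : b ≠ 0) :
    (∃! y : F, y ^ 3 + a * y + b = 0) ↔ Algebra.trace (ZMod 2) F (a ^ 3 / b ^ 2 + 1) = 1 := by
  have : CharP F 2 := charP_of_injective_algebraMap (algebraMap (ZMod 2) F).injective 2
  have h2 : (2 : F) = 0 := CharTwo.two_eq_zero
  have hd : a ^ 3 / b ^ 2 + 1 ≠ 1 := by simp [ha, hb]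
  rw [← existsUnique_cubic_root_iff_trace hd]
  have hfwd {y : F} (hy : y ^ 3 + a * y + b = 0) :
      a * y + b ≠ 0 ∧ (b / (a * y + b)) ^ 3 + (a ^ 3 / b ^ 2 + 1) * (b / (a * y + b)) ^ 2 +
        b / (a * y + b) + 1 = 0 := by
    have hne : a * y + b ≠ 0 := by
      intro h
      have hy0 : y = 0 := pow_eq_zero_iff three_ne_zero |>.mp (by linear_combination hy - h)
      simp [hy0, hb] at h
    refine ⟨hne, ?_⟩
    field_simp
    linear_combination a ^ 3 * hy + (2 * b * a ^ 2 * y ^ 2 + 3 * b ^ 2 * a * y + 2 * b ^ 3) * h2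
  have hbwd {s : F} (hs : s ^ 3 + (a ^ 3 / b ^ 2 + 1) * s ^ 2 + s + 1 = 0) :
      s ≠ 0 ∧ (b / a * (s⁻¹ + 1)) ^ 3 + a * (b / a * (s⁻¹ + 1)) + b = 0 := by
    have hs0 : s ≠ 0 := by rintro rfl; simp at hs
    refine ⟨hs0, ?_⟩
    field_simp at hs ⊢
    linear_combination b * hs + (b ^ 3 * (s + s ^ 2) + a ^ 3 * b * s ^ 3) * h2
  have hinv {y : F} (hy : a * y + b ≠ 0) : b / a * ((b / (a * y + b))⁻¹ + 1) = y := by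
    field_simp
    linear_combination b * h2
  have hinv' {s : F} (hs : s ≠ 0) : b / (a * (b / a * (s⁻¹ + 1)) + b) = s := by
    have : a * (b / a * (s⁻¹ + 1)) + b = b / s := by
      field_simp
      linear_combination s * h2
    rw [this]
    field_simp
  constructor
  · rintro ⟨y, hy, huniq⟩
    refine ⟨b / (a * y + b), (hfwd hy).2, fun s hs => ?_⟩
    rw [← hinv' (hbwd hs).1, huniq _ (hbwd hs).2]
  · rintro ⟨s, hs, huniq⟩
    refine ⟨b / a * (s⁻¹ + 1), (hbwd hs).2, fun y hy => ?_⟩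
    rw [← hinv (hfwd hy).1, huniq _ (hfwd hy).2]

end CubicCharTwo

/-- Lemma 4.3: criterion for a cubic over `GF(2^n)` to have a unique root. -/
theorem stmt_12 (n : ℕ) (hn : 0 < n) (σ₁ σ₂ σ₃ : GaloisField 2 n)
    (h1 : σ₁ ^ 2 ≠ σ₂) (h2 : σ₃ ≠ σ₁ * σ₂) :
    (∃! x : GaloisField 2 n, x ^ 3 + σ₁ * x ^ 2 + σ₂ * x + σ₃ = 0) ↔
      Tr n ((σ₂ + σ₁ ^ 2) ^ 3 / (σ₃ + σ₁ * σ₂) ^ 2 + 1) = 1 := by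
  have htwo : (2 : GaloisField 2 n) = 0 := CharTwo.two_eq_zero
  have ha : σ₂ + σ₁ ^ 2 ≠ 0 := by
    rw [Ne, CharTwo.add_eq_zero]
    exact h1.symm
  have hb : σ₃ + σ₁ * σ₂ ≠ 0 := by rwa [Ne, CharTwo.add_eq_zero]
  rw [Tr, ← existsUnique_depressed_cubic_root_iff_trace ha hb]
  refine (Equiv.addRight σ₁).existsUnique_congr fun x => ?_
  have : (x + σ₁) ^ 3 + (σ₂ + σ₁ ^ 2) * (x + σ₁) + (σ₃ + σ₁ * σ₂) =
      x ^ 3 + σ₁ * x ^ 2 + σ₂ * x + σ₃ := by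
    linear_combination (σ₁ * x ^ 2 + 2 * σ₁ ^ 2 * x + σ₁ ^ 3 + σ₁ * σ₂) * htwo
  rw [Equiv.coe_addRight, this]
end
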